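/- arXiv:2507.19719 — 2 statements merged into one kernel-verified Lean document; each statement's English description precedes it below -/
import Mathlib

section
/- Let k be a field and let p, q ∈ k be nonzero with r ∈ k satisfying r·(p³ − q³) = 0. Then there exist k-linear maps ∂_x, ∂_y, ∂_z : S(p,q,r) → S(p,q,r) such that ∂_x(x) = 1, ∂_x(y) = ∂_x(z) = 0, ∂_y(y) = 1, ∂_y(x) = ∂_y(z) = 0, ∂_z(z) = 1, ∂_z(x) = ∂_z(y) = 0, and for all a, b ∈ S(p,q,r): ∂_x(ab) = ∂_x(a)·b + ν_x(a)·∂_x(b), ∂_y(ab) = ∂_y(a)·b + ν_y(a)·∂_y(b), and ∂_z(ab) = ∂_z(a)·b + ν_z(a)·∂_z(b). -/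
noncomputable section

variable (k : Type*) [Field k]

/-- The generators `x = g3 0`, `y = g3 1`, `z = g3 2` of the free algebra `k⟨x,y,z⟩`. -/
def g3 (i : Fin 3) : FreeAlgebra k (Fin 3) := FreeAlgebra.ι k i

/-- The relation whose induced ring quotient is the quotient of `k⟨x,y,z⟩` by the two-sided
ideal generated by `p·yz + q·zy + r·x²`, `p·zx + q·xz + r·y²` and `p·xy + q·yx + r·z²`. -/
def sklyRel (p q r : k) : FreeAlgebra k (Fin 3) → FreeAlgebra k (Fin 3) → Prop := fun a b =>
  b = 0 ∧
    (a = algebraMap k _ p * (g3 k 1 * g3 k 2) + algebraMap k _ q * (g3 k 2 * g3 k 1)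
          + algebraMap k _ r * (g3 k 0 * g3 k 0) ∨
     a = algebraMap k _ p * (g3 k 2 * g3 k 0) + algebraMap k _ q * (g3 k 0 * g3 k 2)
          + algebraMap k _ r * (g3 k 1 * g3 k 1) ∨
     a = algebraMap k _ p * (g3 k 0 * g3 k 1) + algebraMap k _ q * (g3 k 1 * g3 k 0)
          + algebraMap k _ r * (g3 k 2 * g3 k 2))

/-- The three-dimensional Sklyanin algebra `S(p,q,r)`. -/
abbrev Skly3 (p q r : k) : Type _ := RingQuot (sklyRel k p q r)

/-- The images of the generators `x, y, z` in `S(p,q,r)`. -/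
def sgen (p q r : k) (i : Fin 3) : Skly3 k p q r :=
  RingQuot.mkAlgHom k (sklyRel k p q r) (g3 k i)

/-- The defining relations of `S(p,q,r)`, as equations between its generators. -/
theorem sgen_relations (p q r : k) :
    p • (sgen k p q r 1 * sgen k p q r 2) + q • (sgen k p q r 2 * sgen k p q r 1)
        + r • (sgen k p q r 0 * sgen k p q r 0) = 0 ∧
      p • (sgen k p q r 2 * sgen k p q r 0) + q • (sgen k p q r 0 * sgen k p q r 2)
        + r • (sgen k p q r 1 * sgen k p q r 1) = 0 ∧
      p • (sgen k p q r 0 * sgen k p q r 1) + q • (sgen k p q r 1 * sgen k p q r 0)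
        + r • (sgen k p q r 2 * sgen k p q r 2) = 0 := by
  have h : ∀ a, sklyRel k p q r a 0 → RingQuot.mkAlgHom k (sklyRel k p q r) a = 0 := fun a ha => by
    simpa using RingQuot.mkAlgHom_rel k ha
  have h1 := h _ ⟨rfl, Or.inl rfl⟩
  have h2 := h _ ⟨rfl, Or.inr (Or.inl rfl)⟩
  have h3 := h _ ⟨rfl, Or.inr (Or.inr rfl)⟩
  simp only [← Algebra.smul_def, map_add, map_smul, map_mul] at h1 h2 h3
  exact ⟨h1, h2, h3⟩

/-- Elements of an algebra satisfying the relations of `S(p,q,r)` are the images of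
the generators under a homomorphism. -/
theorem exists_algHom_of_relations (p q r : k) {B : Type*} [Ring B] [Algebra k B] (m : Fin 3 → B)
    (h1 : p • (m 1 * m 2) + q • (m 2 * m 1) + r • (m 0 * m 0) = 0)
    (h2 : p • (m 2 * m 0) + q • (m 0 * m 2) + r • (m 1 * m 1) = 0)
    (h3 : p • (m 0 * m 1) + q • (m 1 * m 0) + r • (m 2 * m 2) = 0) :
    ∃ Φ : Skly3 k p q r →ₐ[k] B, ∀ i, Φ (sgen k p q r i) = m i := by
  refine ⟨RingQuot.liftAlgHom k ⟨FreeAlgebra.lift k m, ?_⟩, fun i => ?_⟩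
  · rintro a b ⟨rfl, rfl | rfl | rfl⟩ <;>
      simpa [g3, ← Algebra.smul_def]
  · simp [sgen, g3]

/-- A quadratic relation between upper triangular matrices may be checked entrywise. -/
theorem upperTriangular_relation (p q r : k) {B : Type*} [Ring B] [Algebra k B]
    {a₁ a₂ a₃ v₁ v₂ v₃ b₁ b₂ b₃ : B}
    (ha : p • (a₁ * a₂) + q • (a₂ * a₁) + r • (a₃ * a₃) = 0)
    (hv : p • (v₁ * b₂ + a₁ * v₂) + q • (v₂ * b₁ + a₂ * v₁) + r • (v₃ * b₃ + a₃ * v₃) = 0)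
    (hb : p • (b₁ * b₂) + q • (b₂ * b₁) + r • (b₃ * b₃) = 0) :
    p • (!![a₁, v₁; 0, b₁] * !![a₂, v₂; 0, b₂]) + q • (!![a₂, v₂; 0, b₂] * !![a₁, v₁; 0, b₁])
      + r • (!![a₃, v₃; 0, b₃] * !![a₃, v₃; 0, b₃]) = 0 := by
  ext i j
  fin_cases i <;> fin_cases j
  · simpa using ha
  · simpa [add_comm, add_left_comm] using hv
  · simp
  · simpa using hb

/-- Values on the generators extend to a `ν`-twisted derivation of `S(p,q,r)` as soon as the
twisted Leibniz rule is compatible with the three relations. -/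
theorem exists_twisted_derivation (p q r : k) (ν : Skly3 k p q r →ₐ[k] Skly3 k p q r)
    (v : Fin 3 → Skly3 k p q r)
    (h1 : p • (v 1 * sgen k p q r 2 + ν (sgen k p q r 1) * v 2)
      + q • (v 2 * sgen k p q r 1 + ν (sgen k p q r 2) * v 1)
      + r • (v 0 * sgen k p q r 0 + ν (sgen k p q r 0) * v 0) = 0)
    (h2 : p • (v 2 * sgen k p q r 0 + ν (sgen k p q r 2) * v 0)
      + q • (v 0 * sgen k p q r 2 + ν (sgen k p q r 0) * v 2)
      + r • (v 1 * sgen k p q r 1 + ν (sgen k p q r 1) * v 1) = 0)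
    (h3 : p • (v 0 * sgen k p q r 1 + ν (sgen k p q r 0) * v 1)
      + q • (v 1 * sgen k p q r 0 + ν (sgen k p q r 1) * v 0)
      + r • (v 2 * sgen k p q r 2 + ν (sgen k p q r 2) * v 2) = 0) :
    ∃ D : Skly3 k p q r →ₗ[k] Skly3 k p q r,
      (∀ i, D (sgen k p q r i) = v i) ∧ ∀ a b, D (a * b) = D a * b + ν a * D b := by
  obtain ⟨e1, e2, e3⟩ := sgen_relations k p q r
  have n1 := congrArg ν e1
  have n2 := congrArg ν e2
  have n3 := congrArg ν e3
  simp only [map_add, map_smul, map_mul, map_zero] at n1 n2 n3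
  obtain ⟨Φ, hΦ⟩ := exists_algHom_of_relations k p q r
    (B := Matrix (Fin 2) (Fin 2) (Skly3 k p q r))
    (fun i => !![ν (sgen k p q r i), v i; 0, sgen k p q r i])
    (upperTriangular_relation k p q r n1 h1 e1)
    (upperTriangular_relation k p q r n2 h2 e2)
    (upperTriangular_relation k p q r n3 h3 e3)
  have key : ∀ a, Φ a 0 0 = ν a ∧ Φ a 1 0 = 0 ∧ Φ a 1 1 = a := by
    intro a
    obtain ⟨a, rfl⟩ := RingQuot.mkAlgHom_surjective k (sklyRel k p q r) a
    induction a using FreeAlgebra.induction with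
    | grade0 c => simp [AlgHom.commutes, Matrix.algebraMap_matrix_apply]
    | grade1 i =>
      have := hΦ i
      rw [sgen, g3] at this
      simp [this]
    | mul a b ha hb => simp [Matrix.mul_apply, Fin.sum_univ_two, ha, hb]
    | add a b ha hb => simp [ha, hb]
  refine ⟨(Matrix.entryLinearMap k (Skly3 k p q r) 0 1).comp Φ.toLinearMap, fun i => ?_,
    fun a b => ?_⟩
  · simp [hΦ]
  · simp [Matrix.mul_apply, Fin.sum_univ_two, key, add_comm]

/-- There exist `k`-linear maps `∂x, ∂y, ∂z` on `S(p,q,r)` which send the corresponding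
generator to `1`, kill the other two generators, and satisfy the twisted Leibniz rule with
respect to the automorphisms `νx, νy, νz` respectively. -/
theorem sklyanin3_twisted_derivations (p q r : k) (hp : p ≠ 0) (hq : q ≠ 0)
    (hr : r * (p ^ 3 - q ^ 3) = 0)
    (νx νy νz : Skly3 k p q r ≃ₐ[k] Skly3 k p q r)
    (hx1 : νx (sgen k p q r 0) = -sgen k p q r 0)
    (hx2 : νx (sgen k p q r 1) = (-(p * q⁻¹)) • sgen k p q r 1)
    (hx3 : νx (sgen k p q r 2) = (-(p⁻¹ * q)) • sgen k p q r 2)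
    (hy1 : νy (sgen k p q r 0) = (-(p⁻¹ * q)) • sgen k p q r 0)
    (hy2 : νy (sgen k p q r 1) = -sgen k p q r 1)
    (hy3 : νy (sgen k p q r 2) = (-(p * q⁻¹)) • sgen k p q r 2)
    (hz1 : νz (sgen k p q r 0) = (-(p * q⁻¹)) • sgen k p q r 0)
    (hz2 : νz (sgen k p q r 1) = (-(p⁻¹ * q)) • sgen k p q r 1)
    (hz3 : νz (sgen k p q r 2) = -sgen k p q r 2) :
    ∃ Dx Dy Dz : Skly3 k p q r →ₗ[k] Skly3 k p q r,
      Dx (sgen k p q r 0) = 1 ∧ Dx (sgen k p q r 1) = 0 ∧ Dx (sgen k p q r 2) = 0 ∧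
      Dy (sgen k p q r 1) = 1 ∧ Dy (sgen k p q r 0) = 0 ∧ Dy (sgen k p q r 2) = 0 ∧
      Dz (sgen k p q r 2) = 1 ∧ Dz (sgen k p q r 0) = 0 ∧ Dz (sgen k p q r 1) = 0 ∧
      (∀ a b : Skly3 k p q r, Dx (a * b) = Dx a * b + νx a * Dx b) ∧
      (∀ a b : Skly3 k p q r, Dy (a * b) = Dy a * b + νy a * Dy b) ∧
      (∀ a b : Skly3 k p q r, Dz (a * b) = Dz a * b + νz a * Dz b) := by
  have c1 : q * (-(p * q⁻¹)) = -p := by field_simp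
  have c2 : p * (-(p⁻¹ * q)) = -q := by field_simp
  obtain ⟨Dx, vx, lx⟩ := exists_twisted_derivation k p q r (νx : _ →ₐ[k] _) ![1, 0, 0]
    (by simp [hx1])
    (by simp [-neg_smul, hx3, smul_smul, c2]; simp)
    (by simp [-neg_smul, hx2, smul_smul, c1]; simp)
  obtain ⟨Dy, vy, ly⟩ := exists_twisted_derivation k p q r (νy : _ →ₐ[k] _) ![0, 1, 0]
    (by simp [-neg_smul, hy3, smul_smul, c1]; simp)
    (by simp [hy2])
    (by simp [-neg_smul, hy1, smul_smul, c2]; simp)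
  obtain ⟨Dz, vz, lz⟩ := exists_twisted_derivation k p q r (νz : _ →ₐ[k] _) ![0, 0, 1]
    (by simp [-neg_smul, hz2, smul_smul, c2]; simp)
    (by simp [-neg_smul, hz1, smul_smul, c1]; simp)
    (by simp [hz3])
  exact ⟨Dx, Dy, Dz, vx 0, vx 1, vx 2, vy 1, vy 0, vy 2, vz 2, vz 0, vz 1, lx, ly, lz⟩
end
end

section
/- Let k be a field, (p,q,r) ∈ k³, and let θ ∈ k satisfy θ³ = 1 and θ ≠ 1. Then there is a k-algebra isomorphism S(p,q,r) → S(p,q,θr) sending x ↦ θ²x, y ↦ y and z ↦ z; in particular the graded algebras S(p,q,r) and S(p,q,θr) are isomorphic. -/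
noncomputable section

variable (k : Type*) [Field k]

variable {k} in
/-- A `k`-algebra map out of `S(p,q,r)` is given by images of the generators that satisfy the
three defining relations. -/
def skly3Lift {p q r : k} {A : Type*} [Ring A] [Algebra k A] (f : Fin 3 → A)
    (h₀ : p • (f 1 * f 2) + q • (f 2 * f 1) + r • (f 0 * f 0) = 0)
    (h₁ : p • (f 2 * f 0) + q • (f 0 * f 2) + r • (f 1 * f 1) = 0)
    (h₂ : p • (f 0 * f 1) + q • (f 1 * f 0) + r • (f 2 * f 2) = 0) :
    Skly3 k p q r →ₐ[k] A :=
  RingQuot.liftAlgHom k ⟨FreeAlgebra.lift k f, by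
    rintro _ _ ⟨rfl, rfl | rfl | rfl⟩ <;>
      simpa [g3, ← Algebra.smul_def]⟩

variable {k} in
theorem skly3Lift_sgen {p q r : k} {A : Type*} [Ring A] [Algebra k A] (f : Fin 3 → A)
    (h₀ : p • (f 1 * f 2) + q • (f 2 * f 1) + r • (f 0 * f 0) = 0)
    (h₁ : p • (f 2 * f 0) + q • (f 0 * f 2) + r • (f 1 * f 1) = 0)
    (h₂ : p • (f 0 * f 1) + q • (f 1 * f 0) + r • (f 2 * f 2) = 0) (i : Fin 3) :
    skly3Lift f h₀ h₁ h₂ (sgen k p q r i) = f i := by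
  simp [skly3Lift, sgen, g3]

variable {k} in
theorem skly3_algHom_ext {p q r : k} {A : Type*} [Ring A] [Algebra k A]
    {f g : Skly3 k p q r →ₐ[k] A} (h : ∀ i, f (sgen k p q r i) = g (sgen k p q r i)) : f = g :=
  RingQuot.ringQuot_ext' k _ _ <| FreeAlgebra.hom_ext <| funext h

theorem sgen_relation_zero (p q r : k) :
    p • (sgen k p q r 1 * sgen k p q r 2) + q • (sgen k p q r 2 * sgen k p q r 1)
      + r • (sgen k p q r 0 * sgen k p q r 0) = 0 := by
  have h := RingQuot.mkAlgHom_rel k (s := sklyRel k p q r) ⟨rfl, Or.inl rfl⟩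
  simpa [sgen, ← Algebra.smul_def] using h

theorem sgen_relation_one (p q r : k) :
    p • (sgen k p q r 2 * sgen k p q r 0) + q • (sgen k p q r 0 * sgen k p q r 2)
      + r • (sgen k p q r 1 * sgen k p q r 1) = 0 := by
  have h := RingQuot.mkAlgHom_rel k (s := sklyRel k p q r) ⟨rfl, Or.inr (Or.inl rfl)⟩
  simpa [sgen, ← Algebra.smul_def] using h

theorem sgen_relation_two (p q r : k) :
    p • (sgen k p q r 0 * sgen k p q r 1) + q • (sgen k p q r 1 * sgen k p q r 0)
      + r • (sgen k p q r 2 * sgen k p q r 2) = 0 := by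
  have h := RingQuot.mkAlgHom_rel k (s := sklyRel k p q r) ⟨rfl, Or.inr (Or.inr rfl)⟩
  simpa [sgen, ← Algebra.smul_def] using h

variable {k} in
/-- The `k`-algebra map `S(p,q,r) → S(p,q,s)` with `x ↦ cx`, `y ↦ y`, `z ↦ z`, defined when
`rc² = s` and `cs = r`. -/
def skly3Rescale (p q : k) {r s c : k} (hs : r * c ^ 2 = s) (hr : c * s = r) :
    Skly3 k p q r →ₐ[k] Skly3 k p q s :=
  skly3Lift ![c • sgen k p q s 0, sgen k p q s 1, sgen k p q s 2]
    (by simpa [smul_smul, ← mul_assoc, show r * c * c = s by rw [← hs]; ring] using sgen_relation_zero k p q s)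
    (by simpa [smul_add, smul_smul, hr, mul_comm c p, mul_comm c q] using
      congrArg (c • ·) (sgen_relation_one k p q s))
    (by simpa [smul_add, smul_smul, hr, mul_comm c p, mul_comm c q] using
      congrArg (c • ·) (sgen_relation_two k p q s))

variable {k} in
theorem skly3Rescale_sgen (p q : k) {r s c : k} (hs : r * c ^ 2 = s) (hr : c * s = r)
    (i : Fin 3) : skly3Rescale p q hs hr (sgen k p q r i) =
      ![c • sgen k p q s 0, sgen k p q s 1, sgen k p q s 2] i :=
  skly3Lift_sgen _ _ _ _ i

variable {k} in
theorem skly3Rescale_comp (p q : k) {r s c d : k} (hs : r * c ^ 2 = s) (hr : c * s = r)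
    (hr' : s * d ^ 2 = r) (hs' : d * r = s) (hcd : c * d = 1) :
    (skly3Rescale p q hr' hs').comp (skly3Rescale p q hs hr) = AlgHom.id k _ := by
  refine skly3_algHom_ext fun i => ?_
  fin_cases i <;> simp [skly3Rescale_sgen, smul_smul, hcd]

/-- For `θ` a nontrivial cube root of unity there is a `k`-algebra isomorphism
`S(p,q,r) → S(p,q,θr)` sending `x ↦ θ²x`, `y ↦ y`, `z ↦ z`; in particular the graded
algebras `S(p,q,r)` and `S(p,q,θr)` are isomorphic. -/
theorem sklyanin3_iso_cube_root (p q r θ : k) (hθ3 : θ ^ 3 = 1) (hθ : θ ≠ 1) :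
    ∃ e : Skly3 k p q r ≃ₐ[k] Skly3 k p q (θ * r),
      e (sgen k p q r 0) = (θ ^ 2) • sgen k p q (θ * r) 0 ∧
      e (sgen k p q r 1) = sgen k p q (θ * r) 1 ∧
      e (sgen k p q r 2) = sgen k p q (θ * r) 2 := by
  have hs : r * (θ ^ 2) ^ 2 = θ * r := by linear_combination θ * r * hθ3
  have hr : θ ^ 2 * (θ * r) = r := by linear_combination r * hθ3
  have hr' : θ * r * θ ^ 2 = r := by linear_combination r * hθ3
  refine ⟨AlgEquiv.ofAlgHom (skly3Rescale p q hs hr) (skly3Rescale p q hr' rfl)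
    (skly3Rescale_comp p q hr' rfl hs hr (by linear_combination hθ3))
    (skly3Rescale_comp p q hs hr hr' rfl (by linear_combination hθ3)), ?_, ?_, ?_⟩ <;>
  simp [skly3Rescale_sgen]
end
end
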